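/- Let x be a nilpotent n×n matrix over F_q of Jordan type λ = (l_h^{n_{l_h}}) with distinct parts l_1 > l_2 > .... Then the number of invertible matrices over F_q commuting with x equals q^{|λ| + 2n(λ)} · Π_h φ_{n_{l_h}}(q^{−1}), where φ_m(t) = Π_{r=1}^{m} (1 − t^r). -/

import Mathlib

open Matrix

/-- Jordan nilpotent matrix with distinct block sizes `d h` and multiplicities `nh h`. -/
def jordanMatrix (k : Type*) [Field k] (m : ℕ) (d nh : Fin m → ℕ) :
    Matrix (Σ h : Fin m, Fin (nh h) × Fin (d h)) (Σ h : Fin m, Fin (nh h) × Fin (d h)) k :=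
  fun a b =>
    if a.1 = b.1 ∧ (a.2.1 : ℕ) = (b.2.1 : ℕ) ∧ (a.2.2 : ℕ) + 1 = (b.2.2 : ℕ) then 1 else 0

section

variable {F : Type*} [Field F] {m : ℕ} {d nh : Fin m → ℕ}

/-- Indices of the free coefficients of a matrix commuting with `jordanMatrix F m d nh`. -/
abbrev CoeffIndex (m : ℕ) (d nh : Fin m → ℕ) : Type :=
  Σ p : (Σ h : Fin m, Fin (nh h)) × (Σ h : Fin m, Fin (nh h)), Fin (min (d p.1.1) (d p.2.1))

/-- The matrix commuting with `jordanMatrix F m d nh` with prescribed free coefficients: within a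
pair of blocks it is constant along diagonals. -/
def toeplitz (c : CoeffIndex m d nh → F) :
    Matrix (Σ h : Fin m, Fin (nh h) × Fin (d h)) (Σ h : Fin m, Fin (nh h) × Fin (d h)) F :=
  fun x y =>
    if hk : (x.2.2 : ℕ) + (d y.1 - 1 - y.2.2) < min (d x.1) (d y.1) then
      c ⟨(⟨x.1, x.2.1⟩, ⟨y.1, y.2.1⟩), ⟨_, hk⟩⟩
    else 0

/-- The diagonal coefficients of the blocks of size `d h`. -/
def leadingCoeff (hdpos : ∀ h, 0 < d h) (c : CoeffIndex m d nh → F) (h : Fin m) :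
    Matrix (Fin (nh h)) (Fin (nh h)) F :=
  fun s t => c ⟨(⟨h, s⟩, ⟨h, t⟩), ⟨d h - 1, by have := hdpos h; simp; omega⟩⟩

theorem jordanMatrix_mul_apply
    (M : Matrix (Σ h : Fin m, Fin (nh h) × Fin (d h)) (Σ h : Fin m, Fin (nh h) × Fin (d h)) F)
    (x y : Σ h : Fin m, Fin (nh h) × Fin (d h)) :
    (jordanMatrix F m d nh * M) x y =
      if hi : (x.2.2 : ℕ) + 1 < d x.1 then M ⟨x.1, x.2.1, ⟨x.2.2 + 1, hi⟩⟩ y else 0 := by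
  rw [Matrix.mul_apply]
  split_ifs with hi
  · rw [Finset.sum_eq_single ⟨x.1, x.2.1, ⟨x.2.2 + 1, hi⟩⟩]
    · simp [jordanMatrix]
    · rintro ⟨h, s, i⟩ - hne
      obtain ⟨h', s', i'⟩ := x
      rw [jordanMatrix, if_neg, zero_mul]
      rintro ⟨h1, h2, h3⟩
      dsimp only at h1 h2 h3
      subst h1
      exact hne (by congr 2 <;> ext <;> simp [h2, h3])
    · simp
  · refine Finset.sum_eq_zero fun z _ => ?_
    obtain ⟨h, s, i⟩ := z
    obtain ⟨h', s', i'⟩ := x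
    rw [jordanMatrix, if_neg, zero_mul]
    rintro ⟨h1, h2, h3⟩
    dsimp only at h1 h2 h3 hi
    subst h1
    omega

theorem mul_jordanMatrix_apply
    (M : Matrix (Σ h : Fin m, Fin (nh h) × Fin (d h)) (Σ h : Fin m, Fin (nh h) × Fin (d h)) F)
    (x y : Σ h : Fin m, Fin (nh h) × Fin (d h)) :
    (M * jordanMatrix F m d nh) x y =
      if 0 < (y.2.2 : ℕ) then M x ⟨y.1, y.2.1, ⟨y.2.2 - 1, by omega⟩⟩ else 0 := by
  rw [Matrix.mul_apply]
  split_ifs with hi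
  · rw [Finset.sum_eq_single ⟨y.1, y.2.1, ⟨y.2.2 - 1, by omega⟩⟩]
    · rw [jordanMatrix, if_pos, mul_one]
      exact ⟨rfl, rfl, by dsimp only; omega⟩
    · rintro ⟨h, s, i⟩ - hne
      obtain ⟨h', s', i'⟩ := y
      rw [jordanMatrix, if_neg, mul_zero]
      rintro ⟨h1, h2, h3⟩
      dsimp only at h1 h2 h3
      subst h1
      exact hne (by congr 2 <;> ext <;> simp [h2, ← h3])
    · simp
  · refine Finset.sum_eq_zero fun z _ => ?_
    rw [jordanMatrix, if_neg, mul_zero]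
    rintro ⟨h1, h2, h3⟩
    omega

theorem toeplitz_commute (c : CoeffIndex m d nh → F) :
    toeplitz c * jordanMatrix F m d nh = jordanMatrix F m d nh * toeplitz c := by
  ext x y
  rw [jordanMatrix_mul_apply, mul_jordanMatrix_apply]
  obtain ⟨h, s, i⟩ := x
  obtain ⟨h', t, j⟩ := y
  simp only [toeplitz]
  have hi := i.2
  have hj := j.2
  have key : 0 < (j : ℕ) →
      (i : ℕ) + (d h' - 1 - (j - 1)) = i + 1 + (d h' - 1 - j) := by omega
  split_ifs with h1 h2 h3 h4 h5 h6 h7 <;> first | rfl | (congr 3; exact key h1) | (exfalso; omega)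

theorem entry_eq_zero_of_commute
    {M : Matrix (Σ h : Fin m, Fin (nh h) × Fin (d h)) (Σ h : Fin m, Fin (nh h) × Fin (d h)) F}
    (hM : M * jordanMatrix F m d nh = jordanMatrix F m d nh * M)
    {h h' : Fin m} (s : Fin (nh h)) (t : Fin (nh h')) (j : ℕ) (hj : j < d h') (i : ℕ)
    (hi : i < d h) (hij : j < i) :
    M ⟨h, s, ⟨i, hi⟩⟩ ⟨h', t, ⟨j, hj⟩⟩ = 0 := by
  induction j generalizing i with
  | zero =>
    obtain ⟨i, rfl⟩ : ∃ l, i = l + 1 := ⟨i - 1, by omega⟩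
    have := congrFun₂ hM ⟨h, s, ⟨i, by omega⟩⟩ ⟨h', t, ⟨0, hj⟩⟩
    rw [jordanMatrix_mul_apply, mul_jordanMatrix_apply] at this
    simpa [hi] using this.symm
  | succ j ih =>
    obtain ⟨i, rfl⟩ : ∃ l, i = l + 1 := ⟨i - 1, by omega⟩
    have := congrFun₂ hM ⟨h, s, ⟨i, by omega⟩⟩ ⟨h', t, ⟨j + 1, hj⟩⟩
    rw [jordanMatrix_mul_apply, mul_jordanMatrix_apply] at this
    simp only [Nat.succ_pos, if_true, hi, dif_pos, Nat.add_sub_cancel] at this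
    rw [← this]
    exact ih _ _ _ (by omega)

theorem entry_eq_of_commute
    {M : Matrix (Σ h : Fin m, Fin (nh h) × Fin (d h)) (Σ h : Fin m, Fin (nh h) × Fin (d h)) F}
    (hM : M * jordanMatrix F m d nh = jordanMatrix F m d nh * M)
    {h h' : Fin m} (s : Fin (nh h)) (t : Fin (nh h')) (l j : ℕ) (hj : j < d h')
    (hl : j + l + 1 = d h') (i : ℕ) (hi : i < d h) :
    M ⟨h, s, ⟨i, hi⟩⟩ ⟨h', t, ⟨j, hj⟩⟩ =
      if hk : i + l < min (d h) (d h') then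
        M ⟨h, s, ⟨i + l, by omega⟩⟩ ⟨h', t, ⟨d h' - 1, by omega⟩⟩ else 0 := by
  induction l generalizing i j with
  | zero =>
    obtain rfl : j = d h' - 1 := by omega
    split_ifs with hk
    · rfl
    · exact entry_eq_zero_of_commute hM s t _ _ _ _ (by omega)
  | succ l ih =>
    have := congrFun₂ hM ⟨h, s, ⟨i, hi⟩⟩ ⟨h', t, ⟨j + 1, by omega⟩⟩
    rw [jordanMatrix_mul_apply, mul_jordanMatrix_apply] at this
    simp only [Nat.succ_pos, if_true, Nat.add_sub_cancel] at this
    rw [this]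
    by_cases hi' : i + 1 < d h
    · rw [dif_pos hi', ih (j + 1) (by omega) (by omega) (i + 1) hi']
      simp only [Nat.add_assoc, Nat.add_comm 1 l]
    · rw [dif_neg hi', dif_neg (by omega)]

/-- Matrices commuting with a Jordan matrix are parametrised by their free coefficients. -/
def toeplitzEquiv (m : ℕ) (d nh : Fin m → ℕ) :
    (CoeffIndex m d nh → F) ≃
      {M : Matrix (Σ h : Fin m, Fin (nh h) × Fin (d h)) (Σ h : Fin m, Fin (nh h) × Fin (d h)) F //
        M * jordanMatrix F m d nh = jordanMatrix F m d nh * M} where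
  toFun c := ⟨toeplitz c, toeplitz_commute c⟩
  invFun M p := M.1 ⟨p.1.1.1, p.1.1.2, ⟨p.2, p.2.2.trans_le (min_le_left _ _)⟩⟩
    ⟨p.1.2.1, p.1.2.2, ⟨d p.1.2.1 - 1, by have := p.2.2; omega⟩⟩
  left_inv c := by
    funext ⟨⟨⟨h, s⟩, ⟨h', t⟩⟩, k⟩
    have hk := k.2
    dsimp only [toeplitz] at hk ⊢
    rw [dif_pos (by omega)]
    simp
  right_inv M := by
    ext ⟨h, s, i⟩ ⟨h', t, j⟩
    exact (entry_eq_of_commute M.2 s t (d h' - 1 - j) j j.2 (by omega) i i.2).symm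

theorem toeplitz_blockTriangular (hd : StrictAnti d) (c : CoeffIndex m d nh → F) :
    (toeplitz c).BlockTriangular fun x => toLex ((x.2.2 : ℕ), x.1) := by
  rintro ⟨h, s, i⟩ ⟨h', t, j⟩ hlt
  rw [toeplitz, dif_neg]
  have hi := i.2
  have hj := j.2
  rcases Prod.Lex.toLex_lt_toLex.1 hlt with h1 | ⟨h1, h2⟩
  · dsimp only at *; omega
  · have := hd h2
    dsimp only at *; omega

theorem det_toeplitz_ne_zero_iff (hd : StrictAnti d) (hdpos : ∀ h, 0 < d h)
    (hnpos : ∀ h, 0 < nh h) (c : CoeffIndex m d nh → F) :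
    (toeplitz c).det ≠ 0 ↔ ∀ h, (leadingCoeff hdpos c h).det ≠ 0 := by
  have hblock (h : Fin m) (i : ℕ) (hi : i < d h) :
      ((toeplitz c).toSquareBlock (fun x => toLex ((x.2.2 : ℕ), x.1)) (toLex (i, h))).det =
        (leadingCoeff hdpos c h).det := by
    let e : Fin (nh h) ≃ {x : Σ h : Fin m, Fin (nh h) × Fin (d h) //
        toLex ((x.2.2 : ℕ), x.1) = toLex (i, h)} :=
      Equiv.ofBijective (fun s => ⟨⟨h, s, ⟨i, hi⟩⟩, rfl⟩) <| by
        constructor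
        · intro s t hst
          simpa using hst
        · rintro ⟨⟨h', s, j⟩, hx⟩
          obtain ⟨h1, h2⟩ := Prod.mk.inj (toLex.injective hx)
          dsimp only at h1 h2
          subst h1 h2
          exact ⟨s, rfl⟩
    rw [← Matrix.det_submatrix_equiv_self e]
    congr 1
    ext s t
    have hk : i + (d h - 1 - i) = d h - 1 := by omega
    have hentry : toeplitz c ⟨h, s, ⟨i, hi⟩⟩ ⟨h, t, ⟨i, hi⟩⟩ = leadingCoeff hdpos c h s t := by
      simp [toeplitz, leadingCoeff, hk, hdpos h]
    exact hentry
  rw [(toeplitz_blockTriangular hd c).det, Finset.prod_ne_zero_iff]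
  constructor
  · intro H h
    have := H (toLex (0, h))
      (Finset.mem_image.2 ⟨⟨h, ⟨0, hnpos h⟩, ⟨0, hdpos h⟩⟩, Finset.mem_univ _, rfl⟩)
    rwa [hblock h 0 (hdpos h)] at this
  · intro H a ha
    obtain ⟨⟨h, s, i⟩, -, rfl⟩ := Finset.mem_image.1 ha
    rw [hblock h i i.2]
    exact H h

/-- Invertible matrices are those with nonzero determinant. -/
noncomputable def glEquivDetNeZero (n K : Type*) [Fintype n] [DecidableEq n] [Field K] :
    GL n K ≃ {A : Matrix n n K // A.det ≠ 0} where
  toFun g := ⟨g, g.det_ne_zero⟩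
  invFun A := GeneralLinearGroup.mkOfDetNeZero A.1 A.2
  left_inv g := by ext; rfl
  right_inv A := rfl

theorem card_centralizer_conj {n : Type*} [Fintype n] [DecidableEq n] (P : GL n F)
    (J : Matrix n n F) :
    Nat.card {g : GL n F // (g : Matrix n n F) * ((P : Matrix n n F) * J * (↑P⁻¹ : Matrix n n F)) =
        (P : Matrix n n F) * J * (↑P⁻¹ : Matrix n n F) * (g : Matrix n n F)} =
      Nat.card {g : GL n F // (g : Matrix n n F) * J = J * (g : Matrix n n F)} := by
  refine (Nat.card_congr ((MulAut.conj P).toEquiv.subtypeEquiv fun g => ?_)).symm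
  simp only [MulEquiv.toEquiv_eq_coe, EquivLike.coe_coe, MulAut.conj_apply, Units.val_mul,
    Matrix.mul_assoc, Units.inv_mul_cancel_left]
  rw [← Matrix.mul_assoc (g : Matrix n n F), ← Matrix.mul_assoc J,
    Units.mul_right_inj, Units.mul_left_inj]

theorem card_subtype_comp_injective {S I A : Type*} [Finite S] [Finite I]
    {f : S → I} (hf : f.Injective) (P : (S → A) → Prop) :
    Nat.card {c : I → A // P (c ∘ f)} * Nat.card A ^ Nat.card S =
      Nat.card {b : S → A // P b} * Nat.card A ^ Nat.card I := by
  classical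
  let e : S ⊕ ↥(Set.range f)ᶜ ≃ I :=
    ((Equiv.ofInjective f hf).sumCongr (Equiv.refl _)).trans (Equiv.Set.sumCompl _)
  let e' : (I → A) ≃ (S → A) × (↥(Set.range f)ᶜ → A) :=
    (e.symm.arrowCongr (Equiv.refl A)).trans (Equiv.sumArrowEquivProdArrow _ _ _)
  have he (c : I → A) : (e' c).1 = c ∘ f := by
    ext s
    simp [e', e, Equiv.sumArrowEquivProdArrow]
  have hcard : Nat.card {c : I → A // P (c ∘ f)} =
      Nat.card {b : S → A // P b} * Nat.card A ^ Nat.card ↥(Set.range f)ᶜ := by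
    rw [← Nat.card_fun, ← Nat.card_prod]
    exact Nat.card_congr ((e'.subtypeEquiv fun c => by rw [he]).trans
      Equiv.prodSubtypeFstEquivSubtypeProd)
  rw [hcard, ← Nat.card_congr e, Nat.card_sum, mul_assoc, ← pow_add, add_comm]

theorem card_pi_det_ne_zero [Fintype F] (m : ℕ) (nh : Fin m → ℕ) :
    Nat.card {b : (Σ h : Fin m, Fin (nh h) × Fin (nh h)) → F //
        ∀ h, (Matrix.of fun s t => b ⟨h, s, t⟩).det ≠ 0} =
      ∏ h, Nat.card (GL (Fin (nh h)) F) := by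
  rw [← Nat.card_pi]
  let e : ((Σ h : Fin m, Fin (nh h) × Fin (nh h)) → F) ≃
      (∀ h, Matrix (Fin (nh h)) (Fin (nh h)) F) :=
    (Equiv.piCurry _).trans (Equiv.piCongrRight fun h => (Equiv.curry _ _ _).trans Matrix.of)
  exact Nat.card_congr ((e.subtypeEquiv fun b => Iff.rfl).trans
    (Equiv.subtypePiEquivPi.trans (Equiv.piCongrRight fun h => (glEquivDetNeZero _ _).symm)))

theorem card_commuting_jordanMatrix [Fintype F] (hd : StrictAnti d) (hdpos : ∀ h, 0 < d h)
    (hnpos : ∀ h, 0 < nh h) :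
    Nat.card {g : GL (Σ h : Fin m, Fin (nh h) × Fin (d h)) F //
        (g : Matrix _ _ F) * jordanMatrix F m d nh = jordanMatrix F m d nh * (g : Matrix _ _ F)} *
        Fintype.card F ^ ∑ h, nh h * nh h =
      (∏ h, Nat.card (GL (Fin (nh h)) F)) *
        Fintype.card F ^ ∑ h, ∑ h', nh h * nh h' * min (d h) (d h') := by
  let f : (Σ h : Fin m, Fin (nh h) × Fin (nh h)) → CoeffIndex m d nh := fun p =>
    ⟨(⟨p.1, p.2.1⟩, ⟨p.1, p.2.2⟩), ⟨d p.1 - 1, by have := hdpos p.1; simp; omega⟩⟩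
  have hf : f.Injective := by
    rintro ⟨h, s, t⟩ ⟨h', s', t'⟩ hst
    have hpair := congrArg Sigma.fst hst
    simp only [f, Prod.mk.injEq, Sigma.mk.injEq] at hpair
    obtain ⟨⟨rfl, h1⟩, -, h2⟩ := hpair
    rw [eq_of_heq h1, eq_of_heq h2]
  have hcard := card_subtype_comp_injective hf
    fun b : _ → F => ∀ h, (Matrix.of fun s t => b ⟨h, s, t⟩).det ≠ 0
  have hI : Nat.card (CoeffIndex m d nh) = ∑ h, ∑ h', nh h * nh h' * min (d h) (d h') := by
    simp [Fintype.sum_prod_type, Fintype.sum_sigma, Finset.mul_sum, mul_assoc]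
  have hS : Nat.card (Σ h : Fin m, Fin (nh h) × Fin (nh h)) = ∑ h, nh h * nh h := by
    simp
  rw [card_pi_det_ne_zero, hI, hS, Nat.card_eq_fintype_card (α := F)] at hcard
  rw [← hcard]
  congr 1
  refine Nat.card_congr ?_
  let comm (A : Matrix (Σ h : Fin m, Fin (nh h) × Fin (d h))
      (Σ h : Fin m, Fin (nh h) × Fin (d h)) F) : Prop :=
    A * jordanMatrix F m d nh = jordanMatrix F m d nh * A
  refine ((glEquivDetNeZero _ F).subtypeEquiv (q := fun A => comm A.1) fun g => Iff.rfl).trans ?_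
  refine (Equiv.subtypeSubtypeEquivSubtypeInter (fun A => A.det ≠ 0) comm).trans ?_
  refine (Equiv.subtypeEquivRight fun A => And.comm).trans ?_
  refine (Equiv.subtypeSubtypeEquivSubtypeInter comm fun A => A.det ≠ 0).symm.trans ?_
  exact ((toeplitzEquiv m d nh).subtypeEquiv fun c =>
    (det_toeplitz_ne_zero_iff hd hdpos hnpos c).symm).symm

theorem card_GL_fin_rat [Fintype F] (n : ℕ) :
    (Nat.card (GL (Fin n) F) : ℚ) = (Fintype.card F : ℚ) ^ (n * n) *
      ∏ r ∈ Finset.range n, (1 - (Fintype.card F : ℚ) ^ (-((r : ℤ) + 1))) := by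
  have hq : (Fintype.card F : ℚ) ≠ 0 := by simp
  have hpow : (Fintype.card F : ℚ) ^ (n * n) =
      ∏ _r ∈ Finset.range n, (Fintype.card F : ℚ) ^ n := by simp [pow_mul]
  rw [card_GL_field, Fin.prod_univ_eq_prod_range
    (fun i => Fintype.card F ^ n - Fintype.card F ^ i) n, ← Finset.prod_range_reflect, hpow,
    Nat.cast_prod, ← Finset.prod_mul_distrib]
  refine Finset.prod_congr rfl fun r hr => ?_
  have hr' := Finset.mem_range.1 hr
  rw [Nat.cast_sub (Nat.pow_le_pow_right Fintype.card_pos (by omega)), mul_sub, mul_one]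
  push_cast
  congr 1
  rw [← zpow_natCast, ← zpow_natCast, ← zpow_add₀ hq]
  congr 1
  omega

theorem sum_range_two_mul_add (N k : ℕ) :
    ∑ t ∈ Finset.range k, (2 * (N + t) + 1) = 2 * N * k + k * k := by
  induction k with
  | zero => simp
  | succ k ih => rw [Finset.sum_range_succ, ih]; ring

theorem sum_min_eq (hd : StrictAnti d) :
    ∑ h, ∑ h', nh h * nh h' * min (d h) (d h') =
      ∑ h : Fin m, ∑ t ∈ Finset.range (nh h),
        (2 * ((∑ h' ∈ Finset.univ.filter (fun h' => h' < h), nh h') + t) + 1) * d h := by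
  have hsplit (h h' : Fin m) : nh h * nh h' * min (d h) (d h') =
      (if h' < h then nh h * nh h' * d h else 0) + (if h < h' then nh h' * nh h * d h' else 0) +
        if h = h' then nh h * nh h * d h else 0 := by
    rcases lt_trichotomy h h' with hlt | rfl | hlt
    · simp [hlt, hlt.not_gt, hlt.ne, (hd hlt).le, mul_comm]
    · simp
    · simp [hlt, hlt.not_gt, hlt.ne', (hd hlt).le]
  simp_rw [hsplit, Finset.sum_add_distrib]
  rw [Finset.sum_comm (f := fun h h' => if h < h' then nh h' * nh h * d h' else 0),
    ← Finset.sum_add_distrib, ← Finset.sum_add_distrib]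
  refine Finset.sum_congr rfl fun h _ => ?_
  rw [← Finset.sum_mul, sum_range_two_mul_add, ← Finset.sum_filter, ← Finset.sum_mul,
    ← Finset.mul_sum]
  simp
  ring

end

/-- for a nilpotent matrix `x` over `F_q` of Jordan type
`λ = (d h ^ nh h)` (i.e. conjugate to the Jordan matrix), the number of invertible
matrices commuting with `x` is `q^{|λ|+2n(λ)} ∏_h φ_{nh h}(q⁻¹)`, where
`φ_m(t) = ∏_{r=1}^m (1 - t^r)`. -/
theorem stmt8 (F : Type*) [Field F] [Fintype F] (q : ℕ) (hq : Fintype.card F = q)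
    (m : ℕ) (d nh : Fin m → ℕ)
    (hd : StrictAnti d) (hdpos : ∀ h, 0 < d h) (hnpos : ∀ h, 0 < nh h)
    (x : Matrix (Σ h : Fin m, Fin (nh h) × Fin (d h)) (Σ h : Fin m, Fin (nh h) × Fin (d h)) F)
    (hx : ∃ P : GL (Σ h : Fin m, Fin (nh h) × Fin (d h)) F,
      x = (P : Matrix _ _ F) * jordanMatrix F m d nh * (↑P⁻¹ : Matrix _ _ F)) :
    (Nat.card {g : GL (Σ h : Fin m, Fin (nh h) × Fin (d h)) F //
        (g : Matrix _ _ F) * x = x * (g : Matrix _ _ F)} : ℚ)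
      = (q : ℚ) ^ (∑ h : Fin m, ∑ t ∈ Finset.range (nh h),
            (2 * ((∑ h' ∈ Finset.univ.filter (fun h' => h' < h), nh h') + t) + 1) * d h)
        * ∏ h : Fin m, ∏ r ∈ Finset.range (nh h), (1 - (q : ℚ) ^ (-((r : ℤ) + 1))) := by
  obtain ⟨P, rfl⟩ := hx
  subst hq
  have hq0 : (Fintype.card F : ℚ) ≠ 0 := by simp
  have hcount := congrArg (Nat.cast (R := ℚ))
    (card_commuting_jordanMatrix (F := F) hd hdpos hnpos)
  push_cast at hcount
  simp_rw [card_GL_fin_rat, Finset.prod_mul_distrib, Finset.prod_pow_eq_pow_sum] at hcount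
  rw [card_centralizer_conj, ← sum_min_eq hd]
  refine mul_right_cancel₀ (pow_ne_zero (∑ h, nh h * nh h) hq0) (hcount.trans ?_)
  ring
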